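/- Let G be a finite simple graph on [d] = {1,...,d} that has an odd hole, i.e., an induced odd cycle of length 2ℓ+1 with ℓ ≥ 2, on vertices {i_1,...,i_{2ℓ+1}}. Then for every finite partially ordered set P on [d], the polytope Ω(O_P, Q_G) = conv((O_P × {1}) ∪ ((−Q_G) × {−1})) ⊂ ℝ^{d+1} does not have the integer decomposition property; in fact the lattice point b = −(e_{i_1} + ... + e_{i_{2ℓ+1}} + 2e_{d+1}) lies in 3·Ω(O_P, Q_G) but is not a sum of three lattice points of Ω(O_P, Q_G). -/

import Mathlib

open scoped Pointwise

namespace HibiTsuchiya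

/-- A point of `ℝ^n` is a *lattice point* if all of its coordinates are integers. -/
def IsLatticePoint {n : ℕ} (x : Fin n → ℝ) : Prop := ∀ i, ∃ z : ℤ, x i = (z : ℝ)

/-- The dual polytope `P^∨ = {x : ⟨x,y⟩ ≤ 1 for all y ∈ P}`. -/
def dualPolytope {n : ℕ} (P : Set (Fin n → ℝ)) : Set (Fin n → ℝ) :=
  {x | ∀ y ∈ P, ∑ i, x i * y i ≤ 1}

/-- A polytope `P ⊆ ℝ^n` is *reflexive* if the origin is an interior point of `P` and the
dual polytope of `P` is again a lattice polytope (i.e. the convex hull of finitely many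
lattice points). -/
def IsReflexive {n : ℕ} (P : Set (Fin n → ℝ)) : Prop :=
  0 ∈ interior P ∧
    ∃ V : Finset (Fin n → ℝ), (∀ v ∈ V, IsLatticePoint v) ∧
      dualPolytope P = convexHull ℝ (V : Set (Fin n → ℝ))

/-- `P` has the *integer decomposition property* if every lattice point of `m • P` (`m ≥ 1`)
is a sum of `m` lattice points of `P`. -/
def HasIDP {n : ℕ} (P : Set (Fin n → ℝ)) : Prop :=
  ∀ m : ℕ, 0 < m → ∀ a : Fin n → ℝ, IsLatticePoint a → a ∈ (m : ℝ) • P →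
    ∃ f : Fin m → Fin n → ℝ, (∀ k, f k ∈ P ∧ IsLatticePoint (f k)) ∧ a = ∑ k, f k

/-- The indicator vector `ρ(S) = ∑_{j ∈ S} e_j` of a subset `S ⊆ [n]`. -/
noncomputable def indicator {n : ℕ} (S : Set (Fin n)) : Fin n → ℝ :=
  S.indicator (fun _ => (1 : ℝ))

/-- A poset ideal of a partial order `P` on `[n]`. -/
def IsPosetIdeal {n : ℕ} (P : PartialOrder (Fin n)) (I : Set (Fin n)) : Prop :=
  ∀ i ∈ I, ∀ j, P.le j i → j ∈ I

/-- The order polytope `O_P`: the convex hull of the indicator vectors of poset ideals. -/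
noncomputable def orderPolytope {n : ℕ} (P : PartialOrder (Fin n)) : Set (Fin n → ℝ) :=
  convexHull ℝ {x | ∃ I : Set (Fin n), IsPosetIdeal P I ∧ x = indicator I}

/-- An antichain of a partial order `P` on `[n]`: a pairwise incomparable subset. -/
def IsPosetAntichain {n : ℕ} (P : PartialOrder (Fin n)) (A : Set (Fin n)) : Prop :=
  ∀ i ∈ A, ∀ j ∈ A, i ≠ j → ¬ P.le i j ∧ ¬ P.le j i

/-- The chain polytope `C_P`: the convex hull of the indicator vectors of antichains. -/
noncomputable def chainPolytope {n : ℕ} (P : PartialOrder (Fin n)) : Set (Fin n → ℝ) :=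
  convexHull ℝ {x | ∃ A : Set (Fin n), IsPosetAntichain P A ∧ x = indicator A}

/-- A stable (independent) set of a graph. -/
def IsStableSet {V : Type*} (G : SimpleGraph V) (S : Set V) : Prop :=
  ∀ i ∈ S, ∀ j ∈ S, ¬ G.Adj i j

/-- The stable set polytope `Q_G`: the convex hull of the indicator vectors of stable sets. -/
noncomputable def stableSetPolytope {n : ℕ} (G : SimpleGraph (Fin n)) : Set (Fin n → ℝ) :=
  convexHull ℝ {x | ∃ S : Set (Fin n), IsStableSet G S ∧ x = indicator S}

/-- The clique number of a graph, as an extended natural number. -/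
noncomputable def cliqueNumber {V : Type*} (G : SimpleGraph V) : ℕ∞ :=
  ⨆ (t : Finset V) (_ : G.IsClique (t : Set V)), (t.card : ℕ∞)

/-- A graph is *perfect* if for every induced subgraph (including the graph itself)
the chromatic number equals the clique number. -/
def IsPerfectGraph {V : Type*} (G : SimpleGraph V) : Prop :=
  ∀ s : Set V, (G.induce s).chromaticNumber = cliqueNumber (G.induce s)

/-- A simplicial complex on the vertex set `[n]`. -/
def IsSimplicialComplex {n : ℕ} (Δ : Set (Finset (Fin n))) : Prop :=
  (∀ i : Fin n, {i} ∈ Δ) ∧ ∀ F ∈ Δ, ∀ F' ⊆ F, F' ∈ Δ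

/-- The polytope `P_Δ`: the convex hull of the indicator vectors of the faces of `Δ`. -/
noncomputable def complexPolytope {n : ℕ} (Δ : Set (Finset (Fin n))) : Set (Fin n → ℝ) :=
  convexHull ℝ {x | ∃ F ∈ Δ, x = indicator (↑F : Set (Fin n))}

/-- `Γ(P,Q) = conv(P ∪ (−Q))`. -/
noncomputable def gammaPolytope {n : ℕ} (P Q : Set (Fin n → ℝ)) : Set (Fin n → ℝ) :=
  convexHull ℝ (P ∪ -Q)

/-- `Ω(P,Q) = conv((P × {1}) ∪ ((−Q) × {−1})) ⊆ ℝ^{n+1}`. -/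
noncomputable def omegaPolytope {n : ℕ} (P Q : Set (Fin n → ℝ)) : Set (Fin (n+1) → ℝ) :=
  convexHull ℝ
    ((fun x : Fin n → ℝ => Fin.snoc x (1 : ℝ)) '' P ∪
     (fun x : Fin n → ℝ => Fin.snoc x (-1 : ℝ)) '' (-Q))

/-- The adjacency relation of the cycle of length `m` on `ZMod m`. -/
def cycleAdj (m : ℕ) (i j : ZMod m) : Prop := i ≠ j ∧ (j = i + 1 ∨ i = j + 1)

/-- `G` has an *odd hole*: an induced odd cycle of length `2ℓ+1 ≥ 5`. -/
def HasOddHole {n : ℕ} (G : SimpleGraph (Fin n)) : Prop :=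
  ∃ ℓ : ℕ, 2 ≤ ℓ ∧ ∃ f : ZMod (2 * ℓ + 1) → Fin n, Function.Injective f ∧
    ∀ i j, G.Adj (f i) (f j) ↔ cycleAdj (2 * ℓ + 1) i j

/-- `G` has an *odd antihole*: an induced subgraph whose complement is an odd cycle of
length `2ℓ+1 ≥ 5`. -/
def HasOddAntihole {n : ℕ} (G : SimpleGraph (Fin n)) : Prop :=
  ∃ ℓ : ℕ, 2 ≤ ℓ ∧ ∃ f : ZMod (2 * ℓ + 1) → Fin n, Function.Injective f ∧
    ∀ i j, G.Adj (f i) (f j) ↔ (i ≠ j ∧ ¬ cycleAdj (2 * ℓ + 1) i j)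

lemma indicator_apply' {n : ℕ} (S : Set (Fin n)) [DecidablePred (· ∈ S)] (i : Fin n) :
    indicator S i = if i ∈ S then 1 else 0 := by
  simp [indicator, Set.indicator_apply]

lemma indicator_nonneg' {n : ℕ} (S : Set (Fin n)) (i : Fin n) : 0 ≤ indicator S i := by
  classical
  rw [indicator_apply']; split_ifs <;> norm_num

lemma order_nonneg {n : ℕ} (P : PartialOrder (Fin n)) (x : Fin n → ℝ)
    (hx : x ∈ orderPolytope P) (i : Fin n) : 0 ≤ x i := by
  have h : orderPolytope P ⊆ {x | 0 ≤ x i} := by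
    apply convexHull_min
    · rintro _ ⟨I, -, rfl⟩
      exact indicator_nonneg' I i
    · intro x hx y hy a b ha hb hab
      simp only [Set.mem_ofPred_eq, Pi.add_apply, Pi.smul_apply, smul_eq_mul] at *
      positivity
  exact h hx

lemma stable_edge {n : ℕ} (G : SimpleGraph (Fin n)) (x : Fin n → ℝ)
    (hx : x ∈ stableSetPolytope G) (i j : Fin n) (hij : G.Adj i j) : x i + x j ≤ 1 := by
  classical
  have h : stableSetPolytope G ⊆ {x | x i + x j ≤ 1} := by
    apply convexHull_min
    · rintro _ ⟨S, hS, rfl⟩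
      have := fun hi hj => hS i hi j hj hij
      simp only [Set.mem_ofPred_eq, indicator_apply']
      split_ifs <;> first | tauto | norm_num
    · intro x hx y hy a b ha hb hab
      simp only [Set.mem_ofPred_eq, Pi.add_apply, Pi.smul_apply, smul_eq_mul] at *
      nlinarith [mul_le_mul_of_nonneg_left hx ha, mul_le_mul_of_nonneg_left hy hb]
  exact h hx

lemma omega_bound {n : ℕ} (P : PartialOrder (Fin n)) (G : SimpleGraph (Fin n))
    (x : Fin (n + 1) → ℝ) (hx : x ∈ omegaPolytope (orderPolytope P) (stableSetPolytope G)) :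
    -1 ≤ x (Fin.last n) ∧ ∀ i j, G.Adj i j →
      -(1 - x (Fin.last n)) ≤ 2 * (x i.castSucc + x j.castSucc) := by
  have h : omegaPolytope (orderPolytope P) (stableSetPolytope G) ⊆
      {x | -1 ≤ x (Fin.last n) ∧ ∀ i j, G.Adj i j →
        -(1 - x (Fin.last n)) ≤ 2 * (x i.castSucc + x j.castSucc)} := by
    apply convexHull_min
    · rintro _ (⟨y, hy, rfl⟩ | ⟨y, hy, rfl⟩)
      · refine ⟨by simp, fun i j hij => ?_⟩
        have h1 := order_nonneg P y hy i
        have h2 := order_nonneg P y hy j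
        simp
        linarith
      · refine ⟨by simp, fun i j hij => ?_⟩
        have h1 := stable_edge G (-y) hy i j hij
        simp at h1 ⊢
        linarith
    · intro x hx y hy a b ha hb hab
      simp only [Set.mem_ofPred_eq, Pi.add_apply, Pi.smul_apply, smul_eq_mul] at *
      refine ⟨?_, fun i j hij => ?_⟩
      · nlinarith [mul_le_mul_of_nonneg_left hx.1 ha, mul_le_mul_of_nonneg_left hy.1 hb]
      · nlinarith [mul_le_mul_of_nonneg_left (hx.2 i j hij) ha,
          mul_le_mul_of_nonneg_left (hy.2 i j hij) hb]
  exact h hx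

/-- The stable set `{0, 2, ..., 2ℓ-2}` of the odd cycle. -/
def evens (ℓ : ℕ) : Finset (ZMod (2 * ℓ + 1)) :=
  (Finset.range ℓ).image (fun j : ℕ => ((2 * j : ℕ) : ZMod (2 * ℓ + 1)))

lemma natCast_inj_of_lt {m a b : ℕ} (ha : a < m) (hb : b < m)
    (h : (a : ZMod m) = (b : ZMod m)) : a = b := by
  have := congrArg ZMod.val h
  rwa [ZMod.val_natCast_of_lt ha, ZMod.val_natCast_of_lt hb] at this

lemma evens_card (ℓ : ℕ) : (evens ℓ).card = ℓ := by
  rw [evens, Finset.card_image_of_injOn, Finset.card_range]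
  intro a ha b hb h
  simp only [Finset.coe_range, Set.mem_Iio] at ha hb
  have := natCast_inj_of_lt (by omega) (by omega) h
  omega

lemma evens_stable (ℓ : ℕ) (s t : ZMod (2 * ℓ + 1)) (hs : s ∈ evens ℓ) (ht : t ∈ evens ℓ) :
    t ≠ s + 1 := by
  simp only [evens, Finset.mem_image, Finset.mem_range] at hs ht
  obtain ⟨a, ha, rfl⟩ := hs
  obtain ⟨b, hb, rfl⟩ := ht
  intro h
  have h' : ((2 * b : ℕ) : ZMod (2 * ℓ + 1)) = ((2 * a + 1 : ℕ) : ZMod (2 * ℓ + 1)) := by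
    rw [h]; push_cast; ring
  have := natCast_inj_of_lt (by omega) (by omega) h'
  omega

lemma q_mem (d : ℕ) (G : SimpleGraph (Fin d)) (ℓ : ℕ) (hℓ : 2 ≤ ℓ)
    (f : ZMod (2 * ℓ + 1) → Fin d) (hf : Function.Injective f)
    (hadj : ∀ i j, G.Adj (f i) (f j) ↔ cycleAdj (2 * ℓ + 1) i j) :
    (2 / 5 : ℝ) • indicator (Set.range f) ∈ stableSetPolytope G := by
  classical
  have hconv : Convex ℝ (stableSetPolytope G) := convex_convexHull ℝ _
  have h0 : (0 : Fin d → ℝ) ∈ stableSetPolytope G := by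
    apply subset_convexHull
    refine ⟨∅, fun i hi => by simp at hi, ?_⟩
    ext i; simp [indicator]
  have hℓ' : (2 : ℝ) ≤ ℓ := by exact_mod_cast hℓ
  let S : ZMod (2 * ℓ + 1) → Set (Fin d) := fun r => f '' {k | k - r ∈ evens ℓ}
  have hS : ∀ r, indicator (S r) ∈ stableSetPolytope G := by
    intro r
    apply subset_convexHull
    refine ⟨S r, ?_, rfl⟩
    rintro _ ⟨a, ha, rfl⟩ _ ⟨b, hb, rfl⟩ hab
    rw [hadj] at hab
    rcases hab.2 with h | h
    · exact evens_stable ℓ _ _ ha hb (by rw [h]; ring)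
    · exact evens_stable ℓ _ _ hb ha (by rw [h]; ring)
  have havg : (∑ r : ZMod (2 * ℓ + 1), (1 / (2 * ℓ + 1) : ℝ) • indicator (S r)) ∈
      stableSetPolytope G := by
    apply hconv.sum_mem
    · intro i _; positivity
    · rw [Finset.sum_const, Finset.card_univ, ZMod.card]
      simp
      field_simp
    · intro i _; exact hS i
  have hc := hconv.smul_mem_of_zero_mem h0 havg
    (t := 2 * (2 * ℓ + 1) / (5 * ℓ)) ⟨by positivity, by
      rw [div_le_one (by positivity)]; linarith⟩
  convert hc using 1
  ext v
  simp only [Pi.smul_apply, Finset.sum_apply, smul_eq_mul, ← Finset.mul_sum]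
  by_cases hv : v ∈ Set.range f
  · obtain ⟨k, rfl⟩ := hv
    have hcount : ∑ r : ZMod (2 * ℓ + 1), indicator (S r) (f k) = (ℓ : ℝ) := by
      have : ∀ r, indicator (S r) (f k) = if k - r ∈ evens ℓ then (1 : ℝ) else 0 := by
        intro r
        rw [indicator_apply']
        simp [S, hf.eq_iff]
      have hsub : (∑ r, if k - r ∈ evens ℓ then (1 : ℝ) else 0) =
          ∑ s, if s ∈ evens ℓ then (1 : ℝ) else 0 :=
        Equiv.sum_comp (Equiv.subLeft k) (fun s => if s ∈ evens ℓ then (1 : ℝ) else 0)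
      rw [Finset.sum_congr rfl (fun r _ => this r), hsub]
      simp [evens_card]
    rw [hcount, indicator_apply']
    simp
    field_simp
  · have : ∀ r, indicator (S r) v = 0 := by
      intro r
      rw [indicator_apply', if_neg]
      rintro ⟨a, -, rfl⟩
      exact hv ⟨a, rfl⟩
    rw [indicator_apply', if_neg hv]
    simp [this]

lemma b_mem (d : ℕ) (G : SimpleGraph (Fin d)) (ℓ : ℕ) (hℓ : 2 ≤ ℓ)
    (f : ZMod (2 * ℓ + 1) → Fin d) (hf : Function.Injective f)
    (hadj : ∀ i j, G.Adj (f i) (f j) ↔ cycleAdj (2 * ℓ + 1) i j)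
    (P : PartialOrder (Fin d)) :
    (Fin.snoc (-(indicator (Set.range f))) (-2 : ℝ) : Fin (d + 1) → ℝ) ∈
      (3 : ℝ) • omegaPolytope (orderPolytope P) (stableSetPolytope G) := by
  have hq := q_mem d G ℓ hℓ f hf hadj
  have h0 : (0 : Fin d → ℝ) ∈ orderPolytope P := by
    apply subset_convexHull
    refine ⟨∅, fun i hi => by simp at hi, ?_⟩
    ext i; simp [indicator]
  have hA : (Fin.snoc (0 : Fin d → ℝ) (1 : ℝ) : Fin (d + 1) → ℝ) ∈
      omegaPolytope (orderPolytope P) (stableSetPolytope G) :=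
    subset_convexHull ℝ _ (Or.inl ⟨0, h0, rfl⟩)
  have hB : (Fin.snoc (-((2 / 5 : ℝ) • indicator (Set.range f)) : Fin d → ℝ) (-1 : ℝ) :
      Fin (d + 1) → ℝ) ∈ omegaPolytope (orderPolytope P) (stableSetPolytope G) :=
    subset_convexHull ℝ _ (Or.inr ⟨_, by simpa using hq, rfl⟩)
  have hconv : Convex ℝ (omegaPolytope (orderPolytope P) (stableSetPolytope G)) :=
    convex_convexHull ℝ _
  refine ⟨_, hconv hA hB (a := 1 / 6) (b := 5 / 6) (by norm_num) (by norm_num) (by norm_num), ?_⟩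
  ext i
  refine Fin.lastCases ?_ (fun i => ?_) i
  · simp; norm_num
  · simp; ring

lemma not_sum (d : ℕ) (G : SimpleGraph (Fin d)) (ℓ : ℕ) (hℓ : 2 ≤ ℓ)
    (f : ZMod (2 * ℓ + 1) → Fin d)
    (hadj : ∀ i j, G.Adj (f i) (f j) ↔ cycleAdj (2 * ℓ + 1) i j)
    (P : PartialOrder (Fin d)) :
    ¬ ∃ g : Fin 3 → Fin (d + 1) → ℝ,
        (∀ k, g k ∈ omegaPolytope (orderPolytope P) (stableSetPolytope G) ∧
          IsLatticePoint (g k)) ∧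
        Fin.snoc (-(indicator (Set.range f))) (-2 : ℝ) = ∑ k, g k := by
  classical
  rintro ⟨g, hg, hsum⟩
  choose z hz using fun k => (hg k).2
  have hlast : ∀ k, -1 ≤ z k (Fin.last d) := by
    intro k
    have := (omega_bound P G _ (hg k).1).1
    rw [hz] at this
    exact_mod_cast this
  have hedge : ∀ k i, -(1 - z k (Fin.last d)) ≤
      2 * (z k (f i).castSucc + z k (f (i + 1)).castSucc) := by
    intro k i
    have hne : i ≠ i + 1 := by
      intro h
      have h1 : ((1 : ℕ) : ZMod (2 * ℓ + 1)) = ((0 : ℕ) : ZMod (2 * ℓ + 1)) := by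
        push_cast
        simpa using h
      have := natCast_inj_of_lt (by omega) (by omega) h1
      omega
    have := (omega_bound P G _ (hg k).1).2 (f i) (f (i + 1)) ((hadj _ _).2 ⟨hne, Or.inl rfl⟩)
    simp only [hz] at this
    exact_mod_cast this
  have hsl : z 0 (Fin.last d) + z 1 (Fin.last d) + z 2 (Fin.last d) = -2 := by
    have := congrFun hsum (Fin.last d)
    simp only [Fin.snoc_last, Finset.sum_apply, Fin.sum_univ_three, hz] at this
    exact_mod_cast this.symm
  have hsv : ∀ i, z 0 (f i).castSucc + z 1 (f i).castSucc + z 2 (f i).castSucc = -1 := by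
    intro i
    have := congrFun hsum (f i).castSucc
    simp only [Fin.snoc_castSucc, Finset.sum_apply, Fin.sum_univ_three, hz, Pi.neg_apply,
      indicator_apply', Set.mem_range_self, if_true] at this
    exact_mod_cast this.symm
  have hl0 := hlast 0
  have hl1 := hlast 1
  have hl2 := hlast 2
  obtain ⟨k, hk⟩ : ∃ k, ∀ i, z k (f i).castSucc + z k (f (i + 1)).castSucc = -1 := by
    have key : z 0 (Fin.last d) = -1 ∨ z 1 (Fin.last d) = -1 := by omega
    rcases key with h | h
    · refine ⟨0, fun i => ?_⟩
      have h0 := hedge 0 i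
      have h1 := hedge 1 i
      have h2 := hedge 2 i
      have h3 := hsv i
      have h4 := hsv (i + 1)
      omega
    · refine ⟨1, fun i => ?_⟩
      have h0 := hedge 0 i
      have h1 := hedge 1 i
      have h2 := hedge 2 i
      have h3 := hsv i
      have h4 := hsv (i + 1)
      omega
  have htot : ∑ i : ZMod (2 * ℓ + 1), (z k (f i).castSucc + z k (f (i + 1)).castSucc)
      = -(2 * ℓ + 1) := by
    rw [Finset.sum_congr rfl (fun i _ => hk i), Finset.sum_const, Finset.card_univ, ZMod.card]
    simp
  have hshift : ∑ i : ZMod (2 * ℓ + 1), z k (f (i + 1)).castSucc =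
      ∑ i : ZMod (2 * ℓ + 1), z k (f i).castSucc :=
    Equiv.sum_comp (Equiv.addRight (1 : ZMod (2 * ℓ + 1))) (fun i => z k (f i).castSucc)
  rw [Finset.sum_add_distrib, hshift] at htot
  omega

/-- If `G` has an odd hole (an induced odd cycle of length `2ℓ+1`, `ℓ ≥ 2`, on the vertices
`f(0), …, f(2ℓ)`), then for every poset `P` on `[d]` the polytope `Ω(O_P, Q_G)` does not
have the integer decomposition property; in fact the lattice point
`b = −(∑_k e_{f(k)} + 2 e_{d+1})` lies in `3 Ω(O_P, Q_G)` but is not a sum of three lattice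
points of `Ω(O_P, Q_G)`. -/
theorem omega_not_idp_of_oddHole (d : ℕ) (G : SimpleGraph (Fin d)) (ℓ : ℕ) (hℓ : 2 ≤ ℓ)
    (f : ZMod (2 * ℓ + 1) → Fin d) (hf : Function.Injective f)
    (hadj : ∀ i j, G.Adj (f i) (f j) ↔ cycleAdj (2 * ℓ + 1) i j)
    (P : PartialOrder (Fin d)) :
    ¬ HasIDP (omegaPolytope (orderPolytope P) (stableSetPolytope G)) ∧
    (Fin.snoc (-(indicator (Set.range f))) (-2 : ℝ) ∈
      (3 : ℝ) • omegaPolytope (orderPolytope P) (stableSetPolytope G)) ∧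
    ¬ ∃ g : Fin 3 → Fin (d + 1) → ℝ,
        (∀ k, g k ∈ omegaPolytope (orderPolytope P) (stableSetPolytope G) ∧
          IsLatticePoint (g k)) ∧
        Fin.snoc (-(indicator (Set.range f))) (-2 : ℝ) = ∑ k, g k := by
  have h1 := b_mem d G ℓ hℓ f hf hadj P
  have h2 := not_sum d G ℓ hℓ f hadj P
  refine ⟨fun h => h2 ?_, h1, h2⟩
  refine h 3 (by norm_num) _ ?_ (by exact_mod_cast h1)
  classical
  intro i
  refine Fin.lastCases ?_ (fun i => ?_) i
  · exact ⟨-2, by simp⟩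
  · by_cases hi : i ∈ Set.range f
    · exact ⟨-1, by simp only [Fin.snoc_castSucc, Pi.neg_apply, indicator_apply', if_pos hi]; simp⟩
    · exact ⟨0, by simp only [Fin.snoc_castSucc, Pi.neg_apply, indicator_apply', if_neg hi]; simp⟩

end HibiTsuchiya
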